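/- arXiv:2211.12431 — 7 statements merged into one kernel-verified Lean document; each statement's English description precedes it below -/
import Mathlib

section
/- Let δ = 97/420, φ = 1.86 - 1/2100, and define β(k) = 0 for integers 0 ≤ k ≤ 8 and β(k) = 1/3 - δ for integers k ≥ 9. Then for every positive integer k, (k-1)·H_2 + 2·H_{k+1} ≤ (k+1)·φ - β(k) - δ. -/
theorem stmt_5 (δ φ : ℚ) (β : ℕ → ℚ)
    (hδ : δ = 97 / 420) (hφ : φ = 1.86 - 1 / 2100)
    (hβ0 : ∀ k : ℕ, k ≤ 8 → β k = 0)
    (hβ9 : ∀ k : ℕ, 9 ≤ k → β k = 1 / 3 - δ) :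
    ∀ k : ℕ, 0 < k →
      ((k : ℚ) - 1) * harmonic 2 + 2 * harmonic (k + 1)
        ≤ ((k : ℚ) + 1) * φ - β k - δ := by
  intro k hk
  rcases Nat.lt_or_ge k 9 with h | h
  · rw [hβ0 k (by omega), hδ, hφ]
    interval_cases k <;> norm_num [harmonic, Finset.sum_range_succ]
  · induction k, h using Nat.le_induction with
    | base =>
      rw [hβ9 9 le_rfl, hδ, hφ]
      norm_num [harmonic, Finset.sum_range_succ]
    | succ n hn ih =>
      have ih := ih (by omega)
      have h2 : harmonic 2 = 3 / 2 := by norm_num [harmonic, Finset.sum_range_succ]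
      have hinv : ((n + 1 + 1 : ℕ) : ℚ)⁻¹ ≤ 11⁻¹ := by
        gcongr
        exact_mod_cast (by omega : 11 ≤ n + 1 + 1)
      rw [hβ9 n hn, h2, hφ] at ih
      rw [hβ9 (n + 1) (by omega), harmonic_succ (n + 1), h2, hφ]
      push_cast at ih hinv ⊢
      linarith
end

section
/- Let δ = 97/420, φ = 1.86 - 1/2100, and define β(k) = 0 for integers 0 ≤ k ≤ 8 and β(k) = 1/3 - δ for integers k ≥ 9. Then for all positive integers k₁ ≤ k, -(k - k₁ - 1)·δ + k₁·H_2 + H_{k+1} + Σ_{j=1}^{k-1} (2/(8+j) - 1/8) + k₁/8 < (k₁+1)·φ - β(k). -/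
/-- One step of the left-hand side (without its `k₁` terms) as `k` grows. -/
theorem harmonic_add_sum_step (n : ℕ) :
    harmonic (n + 2) + (∑ j ∈ Finset.Icc 1 n, (2 / (8 + (j : ℚ)) - 1 / 8)) + (1 / (n + 3)
        + (2 / (9 + (n : ℚ)) - 1 / 8))
      = harmonic (n + 3) + ∑ j ∈ Finset.Icc 1 (n + 1), (2 / (8 + (j : ℚ)) - 1 / 8) := by
  rw [harmonic_succ (n + 2), Finset.sum_Icc_succ_top (by omega)]
  push_cast
  ring

theorem harmonic_add_sum_lt_of_le (n : ℕ) (hn : n ≤ 7) :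
    harmonic (n + 2) + (∑ j ∈ Finset.Icc 1 n, (2 / (8 + (j : ℚ)) - 1 / 8))
      < 186 / 100 + n * (97 / 420) := by
  interval_cases n <;> norm_num [harmonic, Finset.sum_range_succ, Finset.sum_Icc_succ_top]

theorem harmonic_add_sum_lt_of_ge (n : ℕ) (hn : 8 ≤ n) :
    harmonic (n + 2) + (∑ j ∈ Finset.Icc 1 n, (2 / (8 + (j : ℚ)) - 1 / 8))
      < 176 / 100 + n * (97 / 420) := by
  induction n, hn using Nat.le_induction with
  | base => norm_num [harmonic, Finset.sum_range_succ, Finset.sum_Icc_succ_top]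
  | succ n hn ih =>
    have h8 : (8 : ℚ) ≤ n := by exact_mod_cast hn
    have h1 : 1 / ((n : ℚ) + 3) ≤ 1 / 11 :=
      one_div_le_one_div_of_le (by norm_num) (by linarith)
    have h2 : 2 / (9 + (n : ℚ)) ≤ 2 / 17 :=
      div_le_div_of_nonneg_left (by norm_num) (by norm_num) (by linarith)
    have step := harmonic_add_sum_step n
    rw [show n + 1 + 2 = n + 3 from rfl, ← step]
    push_cast
    linarith

theorem stmt_6 (δ φ : ℚ) (β : ℕ → ℚ)
    (hδ : δ = 97 / 420) (hφ : φ = 1.86 - 1 / 2100)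
    (hβ0 : ∀ k : ℕ, k ≤ 8 → β k = 0)
    (hβ9 : ∀ k : ℕ, 9 ≤ k → β k = 1 / 3 - δ) :
    ∀ k k₁ : ℕ, 0 < k₁ → k₁ ≤ k →
      -(((k : ℚ) - (k₁ : ℚ) - 1)) * δ + (k₁ : ℚ) * harmonic 2 + harmonic (k + 1)
        + (∑ j ∈ Finset.Icc 1 (k - 1), (2 / (8 + (j : ℚ)) - 1 / 8))
        + (k₁ : ℚ) / 8
        < ((k₁ : ℚ) + 1) * φ - β k := by
  intro k k₁ hk₁ hk
  obtain ⟨n, rfl⟩ : ∃ n, k = n + 1 := ⟨k - 1, by omega⟩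
  have hk₁' : (1 : ℚ) ≤ k₁ := by exact_mod_cast hk₁
  have h2 : harmonic 2 = 3 / 2 := by norm_num [harmonic, Finset.sum_range_succ]
  rw [h2, hδ, hφ, show n + 1 + 1 = n + 2 from rfl, Nat.add_sub_cancel]
  push_cast
  rcases Nat.lt_or_ge n 8 with hn | hn
  · have := harmonic_add_sum_lt_of_le n (by omega)
    rw [hβ0 _ (by omega)]
    linarith
  · have := harmonic_add_sum_lt_of_ge n hn
    rw [hβ9 _ (by omega), hδ]
    linarith
end

section
/- Let δ = 97/420, φ = 1.86 - 1/2100, and define β(k) = 0 for integers 0 ≤ k ≤ 8 and β(k) = 1/3 - δ for integers k ≥ 9. Then for all positive integers k₁ ≤ k, -(k-1)·δ + H_{k+1} + k₁·φ + Σ_{j=1}^{k-1} 1/(16+j) < (k₁+1)·φ - β(k). -/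
/-- The case `k = n + 1` with `k ≤ 8`, where the correction term `β k` vanishes. -/
lemma neg_mul_add_harmonic_add_sum_lt_of_lt {n : ℕ} (hn : n < 8) :
    -(n : ℚ) * (97 / 420) + harmonic (n + 2) + ∑ j ∈ Finset.Icc 1 n, 1 / (16 + (j : ℚ))
      < 1.86 - 1 / 2100 := by
  interval_cases n <;> norm_num [harmonic, Finset.sum_range_succ, Finset.sum_Icc_succ_top]

/-- The case `k = n + 1` with `9 ≤ k`, where `β k = 1 / 3 - δ`. -/
lemma neg_mul_add_harmonic_add_sum_lt_of_le {n : ℕ} (hn : 8 ≤ n) :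
    -(n : ℚ) * (97 / 420) + harmonic (n + 2) + ∑ j ∈ Finset.Icc 1 n, 1 / (16 + (j : ℚ))
      < 1.86 - 1 / 2100 - (1 / 3 - 97 / 420) := by
  induction n, hn using Nat.le_induction with
  | base => norm_num [harmonic, Finset.sum_range_succ, Finset.sum_Icc_succ_top]
  | succ n hn ih =>
    have hn' : (8 : ℚ) ≤ n := by exact_mod_cast hn
    rw [show n + 1 + 2 = (n + 2) + 1 by ring, harmonic_succ,
      Finset.sum_Icc_succ_top (by lia)]
    push_cast
    have h₁ : ((n : ℚ) + 2 + 1)⁻¹ ≤ 1 / 11 := by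
      rw [← one_div]
      exact one_div_le_one_div_of_le (by norm_num) (by linarith)
    have h₂ : 1 / (16 + ((n : ℚ) + 1)) ≤ 1 / 25 :=
      one_div_le_one_div_of_le (by norm_num) (by linarith)
    linarith

theorem stmt_7 (δ φ : ℚ) (β : ℕ → ℚ)
    (hδ : δ = 97 / 420) (hφ : φ = 1.86 - 1 / 2100)
    (hβ0 : ∀ k : ℕ, k ≤ 8 → β k = 0)
    (hβ9 : ∀ k : ℕ, 9 ≤ k → β k = 1 / 3 - δ) :
    ∀ k k₁ : ℕ, 0 < k₁ → k₁ ≤ k →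
      -((k : ℚ) - 1) * δ + harmonic (k + 1) + (k₁ : ℚ) * φ
        + (∑ j ∈ Finset.Icc 1 (k - 1), 1 / (16 + (j : ℚ)))
        < ((k₁ : ℚ) + 1) * φ - β k := by
  intro k k₁ hk₁ hk
  obtain ⟨n, rfl⟩ : ∃ n, k = n + 1 := ⟨k - 1, by lia⟩
  rw [Nat.add_sub_cancel, Nat.cast_add_one, add_sub_cancel_right, add_one_mul]
  rcases lt_or_ge n 8 with hn | hn
  · have h := neg_mul_add_harmonic_add_sum_lt_of_lt hn
    rw [← hδ, ← hφ] at h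
    rw [hβ0 _ (by lia)]
    linarith
  · have h := neg_mul_add_harmonic_add_sum_lt_of_le hn
    rw [← hδ, ← hφ] at h
    rw [hβ9 _ (by lia)]
    linarith
end

section
/- Let δ = 97/420, φ = 1.86 - 1/2100, and define β(k) = 0 for integers 0 ≤ k ≤ 8 and β(k) = 1/3 - δ for integers k ≥ 9. Then for every positive integer k and every integer d ≥ 2, -(k-1)·δ + Σ_{j=1}^{k-1} (2/(d+j) - 1/d) + H_{k+1} ≤ φ - β(k). -/
/-- The sum over `j` that depends on `d` in the estimate, with `n` terms. -/
def shiftedSum (n d : ℕ) : ℚ :=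
  ∑ j ∈ Finset.Icc 1 n, (2 / ((d : ℚ) + (j : ℚ)) - 1 / (d : ℚ))

theorem shiftedSum_succ (n d : ℕ) :
    shiftedSum (n + 1) d = shiftedSum n d + (2 / ((d : ℚ) + (n + 1)) - 1 / (d : ℚ)) := by
  rw [shiftedSum, Finset.sum_Icc_succ_top (by omega), Nat.cast_add_one, shiftedSum]

theorem shiftedSum_sub (n d : ℕ) (hd : 0 < d) :
    shiftedSum n d - shiftedSum n (d + 1)
      = n * ((d : ℚ) - (n + 1)) / (d * (d + 1) * (d + n + 1)) := by
  have hd' : (0 : ℚ) < d := by exact_mod_cast hd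
  induction n with
  | zero => simp [shiftedSum]
  | succ n ih =>
    rw [shiftedSum_succ, shiftedSum_succ, add_sub_add_comm, ih]
    have hn : (0 : ℚ) ≤ n := n.cast_nonneg
    have h1 : (d : ℚ) + (n + 1) ≠ 0 := by positivity
    have h2 : (d : ℚ) + n + 1 ≠ 0 := by positivity
    have h3 : (d : ℚ) + 1 + (n + 1) ≠ 0 := by positivity
    have h4 : (d : ℚ) + (n + 1) + 1 ≠ 0 := by positivity
    push_cast
    field_simp
    ring

/-- As a function of `d`, the sum is largest at `d = n + 1`. -/
theorem shiftedSum_le (n d : ℕ) (hd : 0 < d) : shiftedSum n d ≤ shiftedSum n (n + 1) := by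
  rcases le_total (n + 1) d with h | h
  · induction d, h using Nat.le_induction with
    | base => rfl
    | succ d h ih =>
      have hpos : 0 < d := by omega
      have hnd : (n : ℚ) + 1 ≤ d := by exact_mod_cast h
      have : (0 : ℚ) ≤ n * ((d : ℚ) - (n + 1)) / (d * (d + 1) * (d + n + 1)) :=
        div_nonneg (mul_nonneg (by positivity) (by linarith)) (by positivity)
      linarith [shiftedSum_sub n d hpos, ih hpos]
  · induction h using Nat.decreasingInduction with
    | self => rfl
    | of_succ d h ih =>
      have hnd : (d : ℚ) ≤ n + 1 := by exact_mod_cast h.le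
      have : n * ((d : ℚ) - (n + 1)) / (d * (d + 1) * (d + n + 1)) ≤ 0 :=
        div_nonpos_of_nonpos_of_nonneg
          (mul_nonpos_of_nonneg_of_nonpos (by positivity) (by linarith)) (by positivity)
      linarith [shiftedSum_sub n d hd, ih (by omega)]

/-- The left-hand side of the estimate at `k = n + 1` and its worst case `d = n + 1`. -/
def worstCase (n : ℕ) : ℚ :=
  -n * (97 / 420) + shiftedSum n (n + 1) + harmonic (n + 2)

theorem worstCase_succ_le (n : ℕ) (hn : 3 ≤ n) : worstCase (n + 1) ≤ worstCase n := by
  have hn' : (3 : ℚ) ≤ n := by exact_mod_cast hn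
  have hstep := shiftedSum_sub n (n + 1) n.succ_pos
  have hcast : ((n + 1 : ℕ) : ℚ) - (n + 1) = 0 := by push_cast; ring
  rw [hcast, mul_zero, zero_div] at hstep
  have hincr : 2 / ((n : ℚ) + 1 + 1 + (n + 1)) - 1 / (n + 1 + 1) + 1 / (n + 3) ≤ 97 / 420 := by
    rw [div_sub_div _ _ (by positivity) (by positivity),
      div_add_div _ _ (by positivity) (by positivity),
      div_le_div_iff₀ (by positivity) (by positivity)]
    obtain ⟨m, hm, hm0⟩ : ∃ m : ℚ, (n : ℚ) = m + 3 ∧ 0 ≤ m := ⟨n - 3, by ring, by linarith⟩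
    rw [hm, ← sub_nonneg]
    ring_nf
    positivity
  have hharm : harmonic (n + 1 + 2) = harmonic (n + 2) + 1 / ((n : ℚ) + 3) := by
    rw [show n + 1 + 2 = (n + 2) + 1 by ring, harmonic_succ]
    push_cast
    ring
  simp only [worstCase, shiftedSum_succ, hharm]
  push_cast
  linarith

theorem worstCase_le_of_le {m n : ℕ} (hm : 3 ≤ m) (hmn : m ≤ n) :
    worstCase n ≤ worstCase m := by
  induction n, hmn using Nat.le_induction with
  | base => rfl
  | succ n h ih => exact (worstCase_succ_le n (hm.trans h)).trans ih

theorem worstCase_le (n : ℕ) : worstCase n ≤ 1.86 - 1 / 2100 := by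
  have hsmall : ∀ m ≤ 3, worstCase m ≤ 1.86 - 1 / 2100 := by
    intro m hm
    interval_cases m <;>
      norm_num [worstCase, shiftedSum, harmonic, Finset.sum_Icc_succ_top, Finset.sum_range_succ]
  rcases le_total n 3 with h | h
  · exact hsmall n h
  · exact (worstCase_le_of_le le_rfl h).trans (hsmall 3 le_rfl)

theorem worstCase_le_of_eight_le (n : ℕ) (hn : 8 ≤ n) :
    worstCase n ≤ 1.86 - 1 / 2100 - (1 / 3 - 97 / 420) := by
  refine (worstCase_le_of_le (by norm_num) hn).trans ?_
  norm_num [worstCase, shiftedSum, harmonic, Finset.sum_Icc_succ_top, Finset.sum_range_succ]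

theorem stmt_8 (δ φ : ℚ) (β : ℕ → ℚ)
    (hδ : δ = 97 / 420) (hφ : φ = 1.86 - 1 / 2100)
    (hβ0 : ∀ k : ℕ, k ≤ 8 → β k = 0)
    (hβ9 : ∀ k : ℕ, 9 ≤ k → β k = 1 / 3 - δ) :
    ∀ k d : ℕ, 0 < k → 2 ≤ d →
      -((k : ℚ) - 1) * δ
        + (∑ j ∈ Finset.Icc 1 (k - 1), (2 / ((d : ℚ) + (j : ℚ)) - 1 / (d : ℚ)))
        + harmonic (k + 1)
        ≤ φ - β k := by
  intro k d hk hd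
  obtain ⟨n, rfl⟩ : ∃ n, k = n + 1 := ⟨k - 1, by omega⟩
  have hworst : -(((n + 1 : ℕ) : ℚ) - 1) * δ + shiftedSum n d + harmonic (n + 1 + 1)
      ≤ worstCase n := by
    have := shiftedSum_le n d (by omega)
    rw [hδ, worstCase]
    push_cast
    linarith
  refine hworst.trans ?_
  rw [hφ]
  rcases Nat.lt_or_ge n 8 with h | h
  · rw [hβ0 _ (by omega), sub_zero]
    exact worstCase_le n
  · rw [hβ9 _ (by omega), hδ]
    exact worstCase_le_of_eight_le n h
end

section
/- Let δ = 97/420, φ = 1.86 - 1/2100, and define β(k) = 0 for integers 0 ≤ k ≤ 8 and β(k) = 1/3 - δ for integers k ≥ 9. Then for every positive integer k, Σ_{i=1}^{k-1} (2/(8+i) - 1/8) + H_{k+1} - (k-1)·δ + β(k) < φ. -/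
/-- The expression bounded in the main theorem, without `β`, at `k = n + 1`. -/
def potential (n : ℕ) : ℚ :=
  (∑ i ∈ Finset.Icc 1 n, (2 / (8 + (i : ℚ)) - 1 / 8)) + harmonic (n + 2) - n * (97 / 420)

theorem potential_zero : potential 0 = 3 / 2 := by
  norm_num [potential, harmonic, Finset.sum_range_succ]

theorem potential_succ (n : ℕ) :
    potential (n + 1) =
      potential n + (2 / (9 + (n : ℚ)) + 1 / ((n : ℚ) + 3) - 1 / 8 - 97 / 420) := by
  have h : harmonic (n + 3) = harmonic (n + 2) + 1 / ((n : ℚ) + 3) := by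
    rw [harmonic_succ, one_div]
    push_cast
    ring_nf
  have h9 : 8 + ((n : ℚ) + 1) = 9 + n := by ring
  rw [potential, potential, Finset.sum_Icc_succ_top (by omega), h]
  push_cast
  rw [h9]
  ring

theorem potential_succ_le {n : ℕ} (hn : 3 ≤ n) : potential (n + 1) ≤ potential n := by
  have hn' : (3 : ℚ) ≤ n := by exact_mod_cast hn
  have h₁ : 2 / (9 + (n : ℚ)) ≤ 2 / 12 := by gcongr; linarith
  have h₂ : 1 / ((n : ℚ) + 3) ≤ 1 / 6 := by gcongr; linarith
  rw [potential_succ]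
  linarith

theorem potential_le_of_le {m n : ℕ} (hm : 3 ≤ m) (hmn : m ≤ n) :
    potential n ≤ potential m := by
  induction n, hmn using Nat.le_induction with
  | base => exact le_rfl
  | succ n hmn ih => exact (potential_succ_le (hm.trans hmn)).trans ih

theorem potential_lt (n : ℕ) : potential n < 1.86 - 1 / 2100 := by
  rcases le_total 3 n with hn | hn
  · refine (potential_le_of_le le_rfl hn).trans_lt ?_
    norm_num [potential_succ, potential_zero]
  · interval_cases n <;> norm_num [potential_succ, potential_zero]

theorem potential_add_lt {n : ℕ} (hn : 8 ≤ n) :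
    potential n + (1 / 3 - 97 / 420) < 1.86 - 1 / 2100 := by
  have h : potential 8 + (1 / 3 - 97 / 420) < 1.86 - 1 / 2100 := by
    norm_num [potential_succ, potential_zero]
  linarith [potential_le_of_le (by norm_num) hn]

theorem stmt_9 (δ φ : ℚ) (β : ℕ → ℚ)
    (hδ : δ = 97 / 420) (hφ : φ = 1.86 - 1 / 2100)
    (hβ0 : ∀ k : ℕ, k ≤ 8 → β k = 0)
    (hβ9 : ∀ k : ℕ, 9 ≤ k → β k = 1 / 3 - δ) :
    ∀ k : ℕ, 0 < k →
      (∑ i ∈ Finset.Icc 1 (k - 1), (2 / (8 + (i : ℚ)) - 1 / 8))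
        + harmonic (k + 1) - ((k : ℚ) - 1) * δ + β k < φ := by
  rintro (_ | n) hk
  · omega
  subst hδ hφ
  have h : (∑ i ∈ Finset.Icc 1 (n + 1 - 1), (2 / (8 + (i : ℚ)) - 1 / 8))
      + harmonic (n + 1 + 1) - (((n + 1 : ℕ) : ℚ) - 1) * (97 / 420) = potential n := by
    simp [potential]
  rw [h]
  rcases le_or_gt (n + 1) 8 with hn | hn
  · rw [hβ0 _ hn, add_zero]
    exact potential_lt n
  · rw [hβ9 _ hn]
    exact potential_add_lt (by omega)
end

section
/- Let δ = 97/420, φ = 1.86 - 1/2100, and define β(k) = 0 for integers 0 ≤ k ≤ 8 and β(k) = 1/3 - δ for integers k ≥ 9. Then for every positive integer k, H_{k+1} + Σ_{j=1}^{k-1} 1/(16+j) - (k-1)·δ + β(k) < φ. -/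
/-- From `k = 9` on, passing from `k` to `k + 1` adds `1 / (k + 2) + 1 / (16 + k) < 97 / 420`,
so the bound at `k = 9` persists. -/
lemma harmonic_add_sum_sub_lt (n : ℕ) (hn : 8 ≤ n) :
    harmonic (n + 2) + (∑ j ∈ Finset.Icc 1 n, 1 / (16 + (j : ℚ))) - (n : ℚ) * (97 / 420)
      + (1 / 3 - 97 / 420) < 1.86 - 1 / 2100 := by
  induction n, hn using Nat.le_induction with
  | base => norm_num [harmonic, Finset.sum_range_succ, Finset.sum_Icc_succ_top]
  | succ n hn ih =>
    rw [harmonic_succ, Finset.sum_Icc_succ_top (by omega)]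
    have hn' : (8 : ℚ) ≤ n := by exact_mod_cast hn
    have h₁ : ((n + 2 + 1 : ℕ) : ℚ)⁻¹ ≤ 1 / 11 := by
      rw [← one_div]
      apply one_div_le_one_div_of_le <;> push_cast <;> linarith
    have h₂ : 1 / (16 + ((n + 1 : ℕ) : ℚ)) ≤ 1 / 25 := by
      apply one_div_le_one_div_of_le <;> push_cast <;> linarith
    have h₃ : ((n + 1 : ℕ) : ℚ) * (97 / 420) = n * (97 / 420) + 97 / 420 := by
      push_cast; ring
    rw [show n + 1 + 2 = n + 2 + 1 by ring]
    linarith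

theorem stmt_10 (δ φ : ℚ) (β : ℕ → ℚ)
    (hδ : δ = 97 / 420) (hφ : φ = 1.86 - 1 / 2100)
    (hβ0 : ∀ k : ℕ, k ≤ 8 → β k = 0)
    (hβ9 : ∀ k : ℕ, 9 ≤ k → β k = 1 / 3 - δ) :
    ∀ k : ℕ, 0 < k →
      harmonic (k + 1)
        + (∑ j ∈ Finset.Icc 1 (k - 1), 1 / (16 + (j : ℚ)))
        - ((k : ℚ) - 1) * δ + β k < φ := by
  intro k hk
  obtain ⟨n, rfl⟩ := Nat.exists_eq_succ_of_ne_zero hk.ne'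
  rcases le_or_gt 8 n with hn | hn
  · have h := harmonic_add_sum_sub_lt n hn
    rw [hβ9 _ (by omega), hδ, hφ]
    simpa using h
  · rw [hβ0 _ (by omega), hδ, hφ]
    interval_cases n <;>
      norm_num [harmonic, Finset.sum_range_succ, Finset.sum_Icc_succ_top]
end

section
/- For all nonnegative integers x_L, x_R with x_L + x_R ≥ 1 and all L, R ∈ {0,1}, define P(x_L, x_R, L, R) = Σ_{j=1}^{x_L} (3·H_2 + H_{3j+L}) + Σ_{j=1}^{x_R} (3·H_2 + H_{3j+R}) + 2·H_2 + H_{3x_L + 3x_R + R + L + 2} + H_{3x_L + 3x_R + R + L + 3} - ( (2x_L + 2x_R + 2)·H_2 + (x_L + x_R - 1)·(H_4 + H_5) + H_{3+L} + H_{4+L} + H_{3+R} + H_{4+R} ). Then P(x_L, x_R, L, R) > 0. -/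
theorem harmonic_le_harmonic {m n : ℕ} (h : m ≤ n) : harmonic m ≤ harmonic n :=
  monotone_nat_of_le_succ (fun k => by rw [harmonic_succ]; simp; positivity) h

/-- The difference between the two sides of the inequality in `stmt_15`. -/
def harmonicGap (xL xR L R : ℕ) : ℚ :=
  (∑ j ∈ Finset.Icc 1 xL, (3 * harmonic 2 + harmonic (3 * j + L)))
      + (∑ j ∈ Finset.Icc 1 xR, (3 * harmonic 2 + harmonic (3 * j + R)))
      + 2 * harmonic 2
      + harmonic (3 * xL + 3 * xR + R + L + 2)
      + harmonic (3 * xL + 3 * xR + R + L + 3)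
      - ((2 * (xL : ℚ) + 2 * (xR : ℚ) + 2) * harmonic 2
          + ((xL : ℚ) + (xR : ℚ) - 1) * (harmonic 4 + harmonic 5)
          + harmonic (3 + L) + harmonic (4 + L)
          + harmonic (3 + R) + harmonic (4 + R))

theorem harmonicGap_comm (xL xR L R : ℕ) : harmonicGap xL xR L R = harmonicGap xR xL R L := by
  unfold harmonicGap
  rw [show 3 * xL + 3 * xR + R + L = 3 * xR + 3 * xL + L + R by ring]
  ring

theorem harmonicGap_le_succ (xL xR L R : ℕ) (h : 3 ≤ xL) :
    harmonicGap xL xR L R ≤ harmonicGap (xL + 1) xR L R := by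
  unfold harmonicGap
  have h1 : harmonic 12 ≤ harmonic (3 * (xL + 1) + L) := harmonic_le_harmonic (by omega)
  have h2 : harmonic (3 * xL + 3 * xR + R + L + 2)
      ≤ harmonic (3 * (xL + 1) + 3 * xR + R + L + 2) := harmonic_le_harmonic (by omega)
  have h3 : harmonic (3 * xL + 3 * xR + R + L + 3)
      ≤ harmonic (3 * (xL + 1) + 3 * xR + R + L + 3) := harmonic_le_harmonic (by omega)
  have h4 : harmonic 4 + harmonic 5 ≤ harmonic 2 + harmonic 12 := by
    norm_num [harmonic, Finset.sum_range_succ]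
  rw [Finset.sum_Icc_succ_top (by omega)]
  push_cast
  linarith

theorem harmonicGap_min_le (xL xR L R : ℕ) :
    harmonicGap (min xL 3) xR L R ≤ harmonicGap xL xR L R := by
  rcases le_total xL 3 with h | h
  · rw [min_eq_left h]
  · rw [min_eq_right h]
    induction xL, h using Nat.le_induction with
    | base => exact le_rfl
    | succ n hn ih => exact ih.trans (harmonicGap_le_succ n xR L R hn)

theorem harmonicGap_pos_of_le_three (xL xR L R : ℕ) (hx : 1 ≤ xL + xR) (hL : L ≤ 1) (hR : R ≤ 1)
    (h3L : xL ≤ 3) (h3R : xR ≤ 3) : 0 < harmonicGap xL xR L R := by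
  unfold harmonicGap
  interval_cases L <;> interval_cases R <;> interval_cases xL <;> interval_cases xR <;>
    first
    | omega
    | norm_num [harmonic, Finset.sum_range_succ, Finset.sum_Icc_succ_top]


theorem stmt_15 (xL xR L R : ℕ) (hx : 1 ≤ xL + xR) (hL : L ≤ 1) (hR : R ≤ 1) :
    (∑ j ∈ Finset.Icc 1 xL, (3 * harmonic 2 + harmonic (3 * j + L)))
      + (∑ j ∈ Finset.Icc 1 xR, (3 * harmonic 2 + harmonic (3 * j + R)))
      + 2 * harmonic 2
      + harmonic (3 * xL + 3 * xR + R + L + 2)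
      + harmonic (3 * xL + 3 * xR + R + L + 3)
      - ((2 * (xL : ℚ) + 2 * (xR : ℚ) + 2) * harmonic 2
          + ((xL : ℚ) + (xR : ℚ) - 1) * (harmonic 4 + harmonic 5)
          + harmonic (3 + L) + harmonic (4 + L)
          + harmonic (3 + R) + harmonic (4 + R)) > 0 := by
  change 0 < harmonicGap xL xR L R
  calc
    0 < harmonicGap (min xR 3) (min xL 3) R L :=
      harmonicGap_pos_of_le_three _ _ _ _ (by omega) hR hL (min_le_right _ _) (min_le_right _ _)
    _ ≤ harmonicGap xR (min xL 3) R L := harmonicGap_min_le _ _ _ _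
    _ = harmonicGap (min xL 3) xR L R := harmonicGap_comm _ _ _ _
    _ ≤ harmonicGap xL xR L R := harmonicGap_min_le _ _ _ _
end
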